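/- Equivalence of the Lagrangian and Hamiltonian formalisms for hyperregular higher-order contact systems (coordinate version): Let L be a Lagrangian of order k, let Leg : (ℝⁿ)^{2k} × ℝ → (ℝⁿ)^{2k} × ℝ, Leg(q₀,…,q_{2k−1},z) = (q₀,…,q_{k−1}, p̂⁰,…,p̂^{k−1}, z), be the generalized Legendre map built from the Jacobi–Ostrogradskii momenta, and assume Leg is a smooth diffeomorphism. Let E_L = Σ_{r=1}^{k} Σ_{i=1}^{n} p̂^{r−1}_i q_r^i − L and let H be the smooth function on (ℝⁿ)^{k} × (ℝⁿ)^{k} × ℝ (coordinates (q₀,…,q_{k−1}, p⁰,…,p^{k−1}, z)) with H ∘ Leg = E_L. Then a smooth pair (c, z) with z′(t) = L(c̄ᵏ(t), z(t)) satisfies the 2k-th order Herglotz equations if and only if the curve t ↦ Leg(c̄^{2k−1}(t), z(t)) satisfies the contact Hamilton equations q̇_α^i = ∂H/∂p^α_i, ṗ^α_i = −(∂H/∂q_α^i + p^α_i ∂H/∂z), ż = Σ_{α,i} p^α_i ∂H/∂p^α_i − H (for 0 ≤ α ≤ k−1). -/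

import Mathlib

open scoped BigOperators

noncomputable section

namespace HOC

/-- Infinite-jet coordinates `(q_α)_{α ∈ ℕ}` with each `q_α ∈ ℝⁿ`. -/
abbrev Jet (n : ℕ) := ℕ → Fin n → ℝ

/-- Partial derivative of a jet function with respect to the coordinate `q_α^i`. -/
def pq {n : ℕ} (F : Jet n → ℝ → ℝ) (α : ℕ) (i : Fin n) (q : Jet n) (z : ℝ) : ℝ :=
  deriv (fun s : ℝ => F (Function.update q α (Function.update (q α) i s)) z) (q α i)

/-- Partial derivative of a jet function with respect to `z`. -/
def pz {n : ℕ} (F : Jet n → ℝ → ℝ) (q : Jet n) (z : ℝ) : ℝ :=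
  deriv (fun w => F q w) z

/-- Extension of a function of `(q₀,…,q_k,z)` to the jet space, ignoring higher coordinates. -/
def ext {n : ℕ} (k : ℕ) (L : (Fin (k+1) → Fin n → ℝ) → ℝ → ℝ) : Jet n → ℝ → ℝ :=
  fun q z => L (fun α => q α.val) z

/-- The Lagrangian total derivative `D_L` acting on functions of `(q₀,…,q_r,z)`. -/
def DL {n : ℕ} (Lx : Jet n → ℝ → ℝ) (r : ℕ) (F : Jet n → ℝ → ℝ) : Jet n → ℝ → ℝ :=
  fun q z =>
    (∑ α ∈ Finset.range (r+1), ∑ i : Fin n, q (α+1) i * pq F α i q z)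
      + Lx q z * pz F q z - pz Lx q z * F q z

/-- Iterated Lagrangian total derivative `D_L^α`, applied to a function of order `r`. -/
def DLpow {n : ℕ} (Lx : Jet n → ℝ → ℝ) (r : ℕ) : ℕ → (Jet n → ℝ → ℝ) → (Jet n → ℝ → ℝ)
  | 0, F => F
  | (α+1), F => DL Lx (r + α) (DLpow Lx r α F)

/-- The infinite jet lift of a curve `c : ℝ → ℝⁿ`. -/
def lift {n : ℕ} (c : ℝ → Fin n → ℝ) (t : ℝ) : Jet n :=
  fun α => iteratedDeriv α c t

/-- The `k`-jet lift `c̄ᵏ(t) = (c(t), c'(t), …, c⁽ᵏ⁾(t))`. -/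
def jetk {n : ℕ} (k : ℕ) (c : ℝ → Fin n → ℝ) (t : ℝ) : Fin (k+1) → Fin n → ℝ :=
  fun α => iteratedDeriv α.val c t

/-- Smoothness of a Lagrangian of order `k`. -/
def SmoothL {n k : ℕ} (L : (Fin (k+1) → Fin n → ℝ) → ℝ → ℝ) : Prop :=
  ContDiff ℝ (⊤ : ℕ∞) (fun p : (Fin (k+1) → Fin n → ℝ) × ℝ => L p.1 p.2)

/-- The Jacobi–Ostrogradskii momentum `p̂^{r-1}_i = ∑_{α=0}^{k-r} (-1)^α D_L^α (∂L/∂q_{r+α}^i)`. -/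
def momentum {n : ℕ} (k : ℕ) (L : (Fin (k+1) → Fin n → ℝ) → ℝ → ℝ) (r : ℕ) (i : Fin n) :
    Jet n → ℝ → ℝ :=
  fun q z => ∑ α ∈ Finset.range (k - r + 1),
    (-1:ℝ)^α * DLpow (ext k L) k α (pq (ext k L) (r + α) i) q z

/-- The `2k`-th order Herglotz (contact Euler–Lagrange) equations for the pair `(c, z)`. -/
def HerglotzEqs {n : ℕ} (k : ℕ) (L : (Fin (k+1) → Fin n → ℝ) → ℝ → ℝ)
    (c : ℝ → Fin n → ℝ) (z : ℝ → ℝ) : Prop :=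
  ∀ (t : ℝ) (i : Fin n),
    ∑ α ∈ Finset.range (k+1),
      (-1:ℝ)^α * DLpow (ext k L) k α (pq (ext k L) α i) (lift c t) (z t) = 0

/-- The Herglotz ODE `z'(t) = L(c̄ᵏ(t), z(t))`. -/
def HerglotzODE {n : ℕ} (k : ℕ) (L : (Fin (k+1) → Fin n → ℝ) → ℝ → ℝ)
    (c : ℝ → Fin n → ℝ) (z : ℝ → ℝ) : Prop :=
  ∀ t : ℝ, HasDerivAt z (L (jetk k c t) (z t)) t

/-- The Lagrangian energy `E_L = ∑_{r=1}^{k} ∑_i p̂^{r-1}_i q_r^i - L`. -/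
def energy {n : ℕ} (k : ℕ) (L : (Fin (k+1) → Fin n → ℝ) → ℝ → ℝ) : Jet n → ℝ → ℝ :=
  fun q z =>
    (∑ r ∈ Finset.range k, ∑ i : Fin n, momentum k L (r+1) i q z * q (r+1) i) - ext k L q z

/-- Padding a finite collection of coordinates by zero to an infinite jet. -/
def padJet {n : ℕ} (m : ℕ) (q : Fin m → Fin n → ℝ) : Jet n :=
  fun α => if h : α < m then q ⟨α, h⟩ else 0

/-- The generalized Legendre map in coordinates:
`Leg (q₀,…,q_{2k-1}, z) = (q₀,…,q_{k-1}, p̂⁰,…,p̂^{k-1}, z)`. -/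
def Leg {n : ℕ} (k : ℕ) (L : (Fin (k+1) → Fin n → ℝ) → ℝ → ℝ) :
    ((Fin (2*k) → Fin n → ℝ) × ℝ) → ((Fin (2*k) → Fin n → ℝ) × ℝ) :=
  fun w =>
    (fun β i => if (β : ℕ) < k then w.1 β i
      else momentum k L ((β : ℕ) - k + 1) i (padJet (2*k) w.1) w.2, w.2)


/-- Partial derivative of a phase-space function with respect to the coordinate
indexed by `β` (positions for `β < k`, momenta for `β ≥ k`), component `i`. -/
def pW {n m : ℕ} (H : (Fin m → Fin n → ℝ) × ℝ → ℝ) (β : Fin m) (i : Fin n)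
    (w : (Fin m → Fin n → ℝ) × ℝ) : ℝ :=
  deriv (fun s => H (Function.update w.1 β (Function.update (w.1 β) i s), w.2)) (w.1 β i)

/-- Partial derivative of a phase-space function with respect to `z`. -/
def pWz {n m : ℕ} (H : (Fin m → Fin n → ℝ) × ℝ → ℝ)
    (w : (Fin m → Fin n → ℝ) × ℝ) : ℝ :=
  deriv (fun s => H (w.1, s)) w.2

/-- The image under the Legendre map of the prolongation of the pair `(c,z)`. -/
def legCurve {n : ℕ} (k : ℕ) (L : (Fin (k+1) → Fin n → ℝ) → ℝ → ℝ)
    (c : ℝ → Fin n → ℝ) (z : ℝ → ℝ) (t : ℝ) : (Fin (2*k) → Fin n → ℝ) × ℝ :=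
  Leg k L (fun β => iteratedDeriv β.val c t, z t)


/-- The first `m` coordinates of a jet. -/
def restr {n : ℕ} (m : ℕ) (q : Jet n) : Fin m → Fin n → ℝ := fun α => q α

/-- `F` is a smooth function of `(q₀,…,q_{m-1},z)` only. -/
def IsJet {n : ℕ} (m : ℕ) (F : Jet n → ℝ → ℝ) : Prop :=
  ∃ f : (Fin m → Fin n → ℝ) × ℝ → ℝ, ContDiff ℝ (⊤ : ℕ∞) f ∧ ∀ q z, F q z = f (restr m q, z)

section PhaseSpace

variable {n m : ℕ} {f : (Fin m → Fin n → ℝ) × ℝ → ℝ}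

lemma pW_eq_fderiv (hf : Differentiable ℝ f) (β : Fin m) (i : Fin n)
    (w : (Fin m → Fin n → ℝ) × ℝ) :
    pW f β i w = fderiv ℝ f w (Pi.single β (Pi.single i 1), 0) := by
  have h1 : HasDerivAt (fun s : ℝ => Function.update w.1 β (Function.update (w.1 β) i s))
      (Pi.single β (Pi.single i 1)) (w.1 β i) := by
    refine hasDerivAt_pi.2 fun a => hasDerivAt_pi.2 fun j => ?_
    by_cases ha : a = β
    · subst ha
      by_cases hj : j = i
      · subst hj
        simpa using hasDerivAt_id' (w.1 a j)
      · simpa [hj] using hasDerivAt_const (w.1 a i) (w.1 a j)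
    · simpa [ha] using hasDerivAt_const (w.1 β i) (w.1 a j)
  have h2 := h1.prodMk (hasDerivAt_const (w.1 β i) w.2)
  have h3 : HasFDerivAt f (fderiv ℝ f w)
      (Function.update w.1 β (Function.update (w.1 β) i (w.1 β i)), w.2) := by
    simpa using (hf w).hasFDerivAt
  exact (h3.comp_hasDerivAt (w.1 β i) h2).deriv

lemma pWz_eq_fderiv (hf : Differentiable ℝ f) (w : (Fin m → Fin n → ℝ) × ℝ) :
    pWz f w = fderiv ℝ f w (0, 1) := by
  have h2 := (hasDerivAt_const w.2 w.1).prodMk (hasDerivAt_id w.2)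
  have h3 : HasFDerivAt f (fderiv ℝ f w) (w.1, id w.2) := (hf w).hasFDerivAt
  exact (h3.comp_hasDerivAt w.2 h2).deriv

lemma fderiv_eq_sum_pW (hf : Differentiable ℝ f) (w v : (Fin m → Fin n → ℝ) × ℝ) :
    fderiv ℝ f w v = ∑ β, ∑ i, v.1 β i * pW f β i w + v.2 * pWz f w := by
  have hv : v = ∑ β, ∑ i, v.1 β i •
      ((Pi.single β (Pi.single i 1), 0) : (Fin m → Fin n → ℝ) × ℝ) + v.2 • (0, 1) := by
    refine Prod.ext ?_ ?_
    · ext a j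
      simp [Prod.fst_sum, Finset.sum_apply, Pi.single_apply, apply_ite]
    · simp [Prod.snd_sum]
  conv_lhs => rw [hv]
  simp only [map_add, map_sum, map_smul, smul_eq_mul, pW_eq_fderiv hf, pWz_eq_fderiv hf]

lemma hasDerivAt_comp_pW (hf : Differentiable ℝ f) {Q : ℝ → Fin m → Fin n → ℝ} {z : ℝ → ℝ}
    {Q' : Fin m → Fin n → ℝ} {z' t : ℝ}
    (hQ : ∀ β i, HasDerivAt (fun s => Q s β i) (Q' β i) t) (hz : HasDerivAt z z' t) :
    HasDerivAt (fun s => f (Q s, z s))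
      (∑ β, ∑ i, Q' β i * pW f β i (Q t, z t) + z' * pWz f (Q t, z t)) t := by
  have h1 : HasDerivAt Q Q' t := hasDerivAt_pi.2 fun β => hasDerivAt_pi.2 fun i => hQ β i
  have h2 := (hf (Q t, z t)).hasFDerivAt.comp_hasDerivAt t (h1.prodMk hz)
  rwa [fderiv_eq_sum_pW hf] at h2

lemma contDiff_pW (hf : ContDiff ℝ (⊤ : ℕ∞) f) (β : Fin m) (i : Fin n) :
    ContDiff ℝ (⊤ : ℕ∞) (pW f β i) := by
  have h : pW f β i = fun w => fderiv ℝ f w (Pi.single β (Pi.single i 1), 0) :=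
    funext fun w => pW_eq_fderiv (hf.differentiable (by simp)) β i w
  rw [h]
  exact (hf.fderiv_right (by simp)).clm_apply contDiff_const

lemma contDiff_pWz (hf : ContDiff ℝ (⊤ : ℕ∞) f) : ContDiff ℝ (⊤ : ℕ∞) (pWz f) := by
  have h : pWz f = fun w => fderiv ℝ f w (0, 1) :=
    funext fun w => pWz_eq_fderiv (hf.differentiable (by simp)) w
  rw [h]
  exact (hf.fderiv_right (by simp)).clm_apply contDiff_const

end PhaseSpace

section Jets

variable {n m : ℕ} {F G : Jet n → ℝ → ℝ}

lemma restr_update_of_lt (q : Jet n) {α : ℕ} (h : α < m) (x : Fin n → ℝ) :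
    restr m (Function.update q α x) = Function.update (restr m q) ⟨α, h⟩ x := by
  ext a j
  simp [restr, Function.update_apply, Fin.ext_iff]

lemma restr_update_of_le (q : Jet n) {α : ℕ} (h : m ≤ α) (x : Fin n → ℝ) :
    restr m (Function.update q α x) = restr m q := by
  ext a j
  have : (a : ℕ) ≠ α := by omega
  simp [restr, this]

lemma pq_eq_pW {f : (Fin m → Fin n → ℝ) × ℝ → ℝ} (hF : ∀ q z, F q z = f (restr m q, z))
    {α : ℕ} (h : α < m) (i : Fin n) (q : Jet n) (z : ℝ) :
    pq F α i q z = pW f ⟨α, h⟩ i (restr m q, z) := by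
  simp only [pq, pW, hF, restr_update_of_lt q h]
  rfl

lemma pz_eq_pWz {f : (Fin m → Fin n → ℝ) × ℝ → ℝ} (hF : ∀ q z, F q z = f (restr m q, z))
    (q : Jet n) (z : ℝ) : pz F q z = pWz f (restr m q, z) := by
  simp only [pz, pWz, hF]

namespace IsJet

lemma congr (hF : IsJet m F) {q q' : Jet n} (h : ∀ α < m, q α = q' α) (z : ℝ) :
    F q z = F q' z := by
  obtain ⟨f, -, hf⟩ := hF
  rw [hf, hf]
  congr 2
  ext a j
  simp [restr, h a a.2]

lemma mono (hF : IsJet m F) {m' : ℕ} (h : m ≤ m') : IsJet m' F := by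
  obtain ⟨f, hf, hF⟩ := hF
  refine ⟨fun w => f (fun α => w.1 (Fin.castLE h α), w.2), hf.comp (by fun_prop), fun q z => hF q z⟩

lemma coord {α : ℕ} (h : α < m) (i : Fin n) : IsJet m (fun q _ => q α i) :=
  ⟨fun w => w.1 ⟨α, h⟩ i, by fun_prop, fun _ _ => rfl⟩

lemma const (a : ℝ) : IsJet (n := n) m (fun _ _ => a) :=
  ⟨fun _ => a, contDiff_const, fun _ _ => rfl⟩

lemma add (hF : IsJet m F) (hG : IsJet m G) : IsJet m (fun q z => F q z + G q z) := by
  obtain ⟨f, hf, hF⟩ := hF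
  obtain ⟨g, hg, hG⟩ := hG
  exact ⟨fun w => f w + g w, hf.add hg, fun q z => by simp only [hF, hG]⟩

lemma sub (hF : IsJet m F) (hG : IsJet m G) : IsJet m (fun q z => F q z - G q z) := by
  obtain ⟨f, hf, hF⟩ := hF
  obtain ⟨g, hg, hG⟩ := hG
  exact ⟨fun w => f w - g w, hf.sub hg, fun q z => by simp only [hF, hG]⟩

lemma mul (hF : IsJet m F) (hG : IsJet m G) : IsJet m (fun q z => F q z * G q z) := by
  obtain ⟨f, hf, hF⟩ := hF
  obtain ⟨g, hg, hG⟩ := hG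
  exact ⟨fun w => f w * g w, hf.mul hg, fun q z => by simp only [hF, hG]⟩

lemma sum {ι : Type*} (s : Finset ι) {F : ι → Jet n → ℝ → ℝ} (hF : ∀ a ∈ s, IsJet m (F a)) :
    IsJet m (fun q z => ∑ a ∈ s, F a q z) := by
  classical
  induction s using Finset.induction_on with
  | empty => simpa using const 0
  | insert a s ha ih =>
    simp only [Finset.sum_insert ha]
    exact (hF a (by simp)).add (ih fun b hb => hF b (by simp [hb]))

lemma pq (hF : IsJet m F) (α : ℕ) (i : Fin n) : IsJet m (pq F α i) := by
  obtain ⟨f, hf, hF⟩ := hF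
  by_cases h : α < m
  · exact ⟨pW f ⟨α, h⟩ i, contDiff_pW hf _ _, pq_eq_pW hF h i⟩
  · refine ⟨fun _ => 0, contDiff_const, fun q z => ?_⟩
    simp [HOC.pq, hF, restr_update_of_le q (not_lt.1 h)]

lemma pz (hF : IsJet m F) : IsJet m (pz F) := by
  obtain ⟨f, hf, hF⟩ := hF
  exact ⟨pWz f, contDiff_pWz hf, pz_eq_pWz hF⟩

lemma hasDerivAt (hF : IsJet m F) {q : ℝ → Jet n} {z : ℝ → ℝ} {q' : Jet n} {z' t : ℝ}
    (hq : ∀ α < m, ∀ i, HasDerivAt (fun s => q s α i) (q' α i) t) (hz : HasDerivAt z z' t) :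
    HasDerivAt (fun s => F (q s) (z s))
      (∑ α ∈ Finset.range m, ∑ i, q' α i * HOC.pq F α i (q t) (z t)
        + z' * HOC.pz F (q t) (z t)) t := by
  obtain ⟨f, hf, hF⟩ := hF
  have h := hasDerivAt_comp_pW (hf.differentiable (by simp)) (Q := fun s => restr m (q s))
    (Q' := restr m q') (fun β i => hq β β.2 i) hz
  simp only [hF, pz_eq_pWz hF]
  convert h using 2
  rw [← Fin.sum_univ_eq_sum_range (fun α => ∑ i, q' α i * HOC.pq F α i (q t) (z t))]
  exact Finset.sum_congr rfl fun β _ => Finset.sum_congr rfl fun i _ => by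
    rw [pq_eq_pW hF β.2]; rfl

lemma DL {Lx : Jet n → ℝ → ℝ} {r : ℕ} (hL : IsJet m Lx) (hF : IsJet m F) (hr : r + 1 ≤ m) :
    IsJet (m + 1) (DL Lx r F) := by
  have hm : m ≤ m + 1 := m.le_succ
  refine ((sum _ fun α hα => sum _ fun i _ => ?_).add ((hL.mono hm).mul (hF.pz.mono hm))).sub
    ((hL.pz.mono hm).mul (hF.mono hm))
  rw [Finset.mem_range] at hα
  exact (coord (by omega) i).mul ((hF.pq α i).mono hm)

lemma DLpow {Lx : Jet n → ℝ → ℝ} {r : ℕ} (hL : IsJet (r + 1) Lx) (hF : IsJet (r + 1) F) (a : ℕ) :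
    IsJet (r + a + 1) (DLpow Lx r a F) := by
  induction a with
  | zero => exact hF
  | succ a ih => exact (hL.mono (by omega)).DL ih le_rfl

end IsJet

end Jets

section Momenta

variable {n k : ℕ} {L : (Fin (k+1) → Fin n → ℝ) → ℝ → ℝ}

lemma isJet_ext (hL : SmoothL L) : IsJet (k + 1) (ext k L) :=
  ⟨fun p => L p.1 p.2, hL, fun _ _ => rfl⟩

lemma isJet_momentum (hL : SmoothL L) {r : ℕ} (hr : 1 ≤ r) (hrk : r ≤ k) (i : Fin n) :
    IsJet (2 * k) (momentum k L r i) := by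
  refine IsJet.sum _ fun α hα => (IsJet.const _).mul ?_
  rw [Finset.mem_range] at hα
  exact ((isJet_ext hL).DLpow ((isJet_ext hL).pq _ i) α).mono (by omega)

lemma momentum_self (i : Fin n) : momentum k L k i = pq (ext k L) k i := by
  funext q z
  simp [momentum, DLpow]

lemma herglotzEqs_iff (c : ℝ → Fin n → ℝ) (z : ℝ → ℝ) :
    HerglotzEqs k L c z ↔ ∀ t i, momentum k L 0 i (lift c t) (z t) = 0 := by
  simp [HerglotzEqs, momentum]

lemma hasDerivAt_lift {c : ℝ → Fin n → ℝ} (hc : ContDiff ℝ (⊤ : ℕ∞) c) (t : ℝ) (α : ℕ)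
    (i : Fin n) : HasDerivAt (fun s => lift c s α i) (lift c t (α + 1) i) t := by
  have h : Differentiable ℝ (iteratedDeriv α c) :=
    hc.differentiable_iteratedDeriv α (by exact_mod_cast ENat.natCast_lt_top α)
  have h1 := (h t).hasDerivAt
  rw [← iteratedDeriv_succ] at h1
  exact hasDerivAt_pi.1 h1 i

/-- The Lagrangian total derivative computes the derivative along a solution of `z' = L`. -/
lemma IsJet.hasDerivAt_lift (r : ℕ) {F : Jet n → ℝ → ℝ} (hF : IsJet (r + 1) F)
    {c : ℝ → Fin n → ℝ} (hc : ContDiff ℝ (⊤ : ℕ∞) c) {z : ℝ → ℝ} (hode : HerglotzODE k L c z)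
    (t : ℝ) :
    HasDerivAt (fun s => F (lift c s) (z s))
      (HOC.DL (ext k L) r F (lift c t) (z t)
        + HOC.pz (ext k L) (lift c t) (z t) * F (lift c t) (z t)) t := by
  have h := hF.hasDerivAt (q' := fun α => lift c t (α + 1))
    (fun α _ i => HOC.hasDerivAt_lift hc t α i) (hode t)
  convert h using 1
  simp only [HOC.DL]
  rw [show L (jetk k c t) (z t) = ext k L (lift c t) (z t) from rfl]
  ring

lemma momentum_eq_sub (r : ℕ) (i : Fin n) (q : Jet n) (z : ℝ) :
    momentum k L r i q z = pq (ext k L) r i q z - ∑ α ∈ Finset.range (k - r),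
      (-1 : ℝ) ^ α * DL (ext k L) (k + α)
        (DLpow (ext k L) k α (pq (ext k L) (r + 1 + α) i)) q z := by
  simp only [momentum, Finset.sum_range_succ', DLpow, pow_succ, mul_neg, mul_one, neg_mul,
    Finset.sum_neg_distrib, pow_zero, one_mul, add_zero]
  rw [add_comm, sub_eq_add_neg]
  congr 2
  exact Finset.sum_congr rfl fun α _ => by rw [show r + (α + 1) = r + 1 + α by omega]

lemma hasDerivAt_momentum (hL : SmoothL L) {c : ℝ → Fin n → ℝ} (hc : ContDiff ℝ (⊤ : ℕ∞) c)
    {z : ℝ → ℝ} (hode : HerglotzODE k L c z) {r : ℕ} (hr : r < k) (i : Fin n) (t : ℝ) :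
    HasDerivAt (fun s => momentum k L (r + 1) i (lift c s) (z s))
      (pq (ext k L) r i (lift c t) (z t) - momentum k L r i (lift c t) (z t)
        + pz (ext k L) (lift c t) (z t) * momentum k L (r + 1) i (lift c t) (z t)) t := by
  have h := HasDerivAt.fun_sum (u := Finset.range (k - (r + 1) + 1)) fun α _ =>
    (((isJet_ext hL).DLpow ((isJet_ext hL).pq (r + 1 + α) i) α).hasDerivAt_lift
      (k + α) hc hode t).const_mul ((-1 : ℝ) ^ α)
  refine h.congr_deriv ?_
  rw [momentum_eq_sub r i]
  simp only [momentum, mul_add, Finset.sum_add_distrib, Finset.mul_sum]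
  rw [sub_sub_cancel, show k - r = k - (r + 1) + 1 by omega]
  congr 1
  exact Finset.sum_congr rfl fun α _ => by ring

end Momenta

section Legendre

variable {n k : ℕ} {L : (Fin (k+1) → Fin n → ℝ) → ℝ → ℝ}

lemma padJet_of_lt {m : ℕ} (Q : Fin m → Fin n → ℝ) {α : ℕ} (h : α < m) :
    padJet m Q α = Q ⟨α, h⟩ := by
  simp [padJet, h]

lemma padJet_restr {m : ℕ} (q : Jet n) {α : ℕ} (h : α < m) :
    padJet m (restr m q) α = q α :=
  padJet_of_lt _ h

lemma isJet_energy (hL : SmoothL L) (hk : 1 ≤ k) : IsJet (2 * k) (energy k L) := by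
  refine (IsJet.sum _ fun r hr => IsJet.sum _ fun i _ => ?_).sub ((isJet_ext hL).mono (by omega))
  rw [Finset.mem_range] at hr
  exact (isJet_momentum hL (by omega) (by omega) i).mul (IsJet.coord (by omega) i)

lemma Leg_fst_of_lt (Q : Fin (2 * k) → Fin n → ℝ) (u : ℝ) {β : Fin (2 * k)} (h : (β : ℕ) < k) :
    (Leg k L (Q, u)).1 β = Q β := by
  ext i
  simp [Leg, h]

lemma Leg_fst_of_le (Q : Fin (2 * k) → Fin n → ℝ) (u : ℝ) {β : Fin (2 * k)} (h : k ≤ (β : ℕ))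
    (i : Fin n) :
    (Leg k L (Q, u)).1 β i = momentum k L (β - k + 1) i (padJet (2 * k) Q) u := by
  simp [Leg, not_lt.2 h]

lemma Leg_restr_of_le (hL : SmoothL L) (q : Jet n) (u : ℝ) {β : Fin (2 * k)} (h : k ≤ (β : ℕ))
    (i : Fin n) :
    (Leg k L (restr (2 * k) q, u)).1 β i = momentum k L (β - k + 1) i q u := by
  rw [Leg_fst_of_le _ _ h]
  exact (isJet_momentum hL (by omega) (by omega) i).congr (fun α hα => padJet_restr q hα) u

/-- Directional derivative of the Hamiltonian at a point in the image of the Legendre map. -/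
lemma fderiv_hamiltonian (hk : 1 ≤ k) (hL : SmoothL L)
    (e : ((Fin (2*k) → Fin n → ℝ) × ℝ) ≃ ((Fin (2*k) → Fin n → ℝ) × ℝ))
    (he : ⇑e = Leg k L) (hesm' : ContDiff ℝ (⊤ : ℕ∞) (⇑e.symm))
    {H : (Fin (2*k) → Fin n → ℝ) × ℝ → ℝ} (hHsm : ContDiff ℝ (⊤ : ℕ∞) H)
    (hH : ∀ (Q : Fin (2*k) → Fin n → ℝ) (w : ℝ),
      H (Leg k L (Q, w)) = energy k L (padJet (2*k) Q) w)
    (q : Jet n) (u : ℝ) (v : (Fin (2*k) → Fin n → ℝ) × ℝ) :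
    fderiv ℝ H (Leg k L (restr (2 * k) q, u)) v
      = ∑ a ∈ Finset.range k, ∑ i, padJet (2 * k) v.1 (k + a) i * q (a + 1) i
        + ∑ a ∈ Finset.range (k - 1), ∑ i,
            momentum k L (a + 1) i q u * padJet (2 * k) v.1 (a + 1) i
        - ∑ a ∈ Finset.range k, ∑ i, padJet (2 * k) v.1 a i * pq (ext k L) a i q u
        - v.2 * pz (ext k L) q u := by
  set w := Leg k L (restr (2 * k) q, u) with hw
  set y : ℝ → (Fin (2*k) → Fin n → ℝ) × ℝ := fun s => e.symm (w + s • v) with hy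
  have hLy : ∀ s, Leg k L (y s) = w + s • v := fun s => by rw [← he, hy]; simp
  have hy0 : y 0 = (restr (2 * k) q, u) := by
    simp only [hy, zero_smul, add_zero, hw, ← he, e.symm_apply_apply]
  have hyd : Differentiable ℝ y :=
    (hesm'.differentiable (by simp)).comp (by fun_prop)
  have hyfst : ∀ β i, HasDerivAt (fun s => (y s).1 β i) ((deriv y 0).1 β i) 0 := fun β i =>
    hasDerivAt_pi.1 (hasDerivAt_pi.1 (hyd 0).hasDerivAt.fst β) i
  have hysnd : ∀ s, (y s).2 = u + s * v.2 := fun s => by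
    have := congrArg Prod.snd (hLy s)
    simpa [Leg, hw] using this
  set Y : ℝ → Jet n := fun s => padJet (2 * k) (y s).1 with hY
  set Y' : Jet n := padJet (2 * k) (deriv y 0).1 with hY'
  have hYd : ∀ α < 2 * k, ∀ i, HasDerivAt (fun s => Y s α i) (Y' α i) 0 := fun α hα i => by
    simpa only [hY, hY', padJet_of_lt _ hα] using hyfst ⟨α, hα⟩ i
  have hY0 : ∀ α < 2 * k, Y 0 α = q α := fun α hα => by
    rw [hY]; simp only [hy0]; exact padJet_restr q hα
  have hYbase : ∀ α < k, ∀ i, Y' α i = padJet (2 * k) v.1 α i := fun α hα i => by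
    have hα2 : α < 2 * k := by omega
    refine (hYd α hα2 i).unique ?_
    have h1 : (fun s => Y s α i) = fun s => w.1 ⟨α, hα2⟩ i + s * v.1 ⟨α, hα2⟩ i := by
      funext s
      have := congrFun (congrFun (congrArg Prod.fst (hLy s)) ⟨α, hα2⟩) i
      rw [← Prod.mk.eta (p := y s), Leg_fst_of_lt _ _ hα] at this
      simpa [hY, padJet_of_lt _ hα2] using this
    rw [h1, padJet_of_lt _ hα2]
    simpa using ((hasDerivAt_id (0 : ℝ)).mul_const (v.1 ⟨α, hα2⟩ i)).const_add (w.1 ⟨α, hα2⟩ i)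
  have hmom : ∀ a < k, ∀ i s, momentum k L (a + 1) i (Y s) (y s).2
      = momentum k L (a + 1) i q u + s * padJet (2 * k) v.1 (k + a) i := fun a ha i s => by
    have hα2 : k + a < 2 * k := by omega
    have := congrFun (congrFun (congrArg Prod.fst (hLy s)) ⟨k + a, hα2⟩) i
    rw [← Prod.mk.eta (p := y s), Leg_fst_of_le _ _ (by simp)] at this
    have h2 := Leg_restr_of_le hL q u (β := ⟨k + a, hα2⟩) (by simp) i
    simp only [Prod.fst_add, Pi.add_apply, Prod.smul_fst, Pi.smul_apply, smul_eq_mul, hw, h2,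
      Nat.add_sub_cancel_left] at this
    rw [padJet_of_lt _ hα2]
    exact this
  have hsndd : HasDerivAt (fun s => (y s).2) v.2 0 := by
    simp only [hysnd]
    simpa using ((hasDerivAt_id (0 : ℝ)).mul_const v.2).const_add u
  have hHd : HasDerivAt (fun s : ℝ => H (w + s • v)) (fderiv ℝ H w v) 0 := by
    have h1 : HasDerivAt (fun s : ℝ => w + s • v) v 0 := by
      simpa using ((hasDerivAt_id (0 : ℝ)).smul_const v).const_add w
    have h2 : HasFDerivAt H (fderiv ℝ H w) (w + (0 : ℝ) • v) := by
      simpa using (hHsm.differentiable (by simp) w).hasFDerivAt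
    exact HasFDerivAt.comp_hasDerivAt (0 : ℝ) h2 h1
  have hLd := (isJet_ext hL).hasDerivAt (q := Y) (z := fun s => (y s).2) (q' := Y') (t := 0)
    (fun α hα i => hYd α (by omega) i) hsndd
  have hpd : ∀ a ∈ Finset.range k, HasDerivAt
      (fun s => ∑ i, momentum k L (a + 1) i (Y s) (y s).2 * Y s (a + 1) i)
      (∑ i, (padJet (2 * k) v.1 (k + a) i * q (a + 1) i
        + momentum k L (a + 1) i q u * Y' (a + 1) i)) 0 := fun a ha => by
    rw [Finset.mem_range] at ha
    refine HasDerivAt.fun_sum fun i _ => ?_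
    simp only [hmom a ha]
    have h1 := ((hasDerivAt_id (0 : ℝ)).mul_const (padJet (2 * k) v.1 (k + a) i)).const_add
      (momentum k L (a + 1) i q u)
    have h2 := h1.mul (hYd (a + 1) (by omega) i)
    refine h2.congr_deriv ?_
    simp [hY0 (a + 1) (by omega)]
  have hEd := (HasDerivAt.fun_sum hpd).sub hLd
  have hHE : (fun s : ℝ => H (w + s • v)) = fun s => energy k L (Y s) (y s).2 := by
    funext s
    rw [← hLy, ← Prod.mk.eta (p := y s), hH]
  rw [hHE] at hHd
  have key := hHd.unique hEd
  have hext : ∀ {G : Jet n → ℝ → ℝ}, IsJet (k + 1) G → G (Y 0) (y 0).2 = G q u := fun hG => by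
    rw [hy0]
    exact hG.congr (fun α hα => hY0 α (by omega)) u
  rw [key]
  simp only [hext ((isJet_ext hL).pq _ _), hext (isJet_ext hL).pz, Finset.sum_add_distrib]
  obtain ⟨m, rfl⟩ : ∃ m, k = m + 1 := ⟨k - 1, by omega⟩
  rw [Finset.sum_range_succ (fun a => ∑ i, momentum (m + 1) L (a + 1) i q u * Y' (a + 1) i),
    Finset.sum_range_succ (fun a => ∑ i, Y' a i * pq (ext (m + 1) L) a i q u) (m + 1)]
  have h1 : ∑ a ∈ Finset.range m, ∑ i, momentum (m + 1) L (a + 1) i q u * Y' (a + 1) i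
      = ∑ a ∈ Finset.range m, ∑ i,
          momentum (m + 1) L (a + 1) i q u * padJet (2 * (m + 1)) v.1 (a + 1) i :=
    Finset.sum_congr rfl fun a ha => Finset.sum_congr rfl fun i _ => by
      rw [hYbase (a + 1) (by rw [Finset.mem_range] at ha; omega) i]
  have h2 : ∑ a ∈ Finset.range (m + 1), ∑ i, Y' a i * pq (ext (m + 1) L) a i q u
      = ∑ a ∈ Finset.range (m + 1), ∑ i,
          padJet (2 * (m + 1)) v.1 a i * pq (ext (m + 1) L) a i q u :=
    Finset.sum_congr rfl fun a ha => Finset.sum_congr rfl fun i _ => by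
      rw [hYbase a (by simpa using ha) i]
  rw [h1, h2]
  simp only [momentum_self, Nat.add_sub_cancel]
  simp only [mul_comm (Y' (m + 1) _)]
  ring

lemma sum_padJet_single_mul {m : ℕ} (β : Fin m) (i : Fin n) (α : ℕ) (x : Fin n → ℝ) :
    ∑ j, padJet m (Pi.single β (Pi.single i 1)) α j * x j = if α = β then x i else 0 := by
  by_cases h : α < m
  · rw [padJet_of_lt _ h]
    by_cases hα : α = β
    · subst hα
      simp [Pi.single_apply]
    · have : (⟨α, h⟩ : Fin m) ≠ β := fun h => hα (congrArg Fin.val h)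
      simp [this, hα]
  · have : α ≠ β := by omega
    simp [padJet, h, this]

/-- The partial derivatives of the Hamiltonian with respect to the momenta are the velocities. -/
lemma pW_hamiltonian_momentum
    (hk : 1 ≤ k) (hL : SmoothL L)
    (e : ((Fin (2*k) → Fin n → ℝ) × ℝ) ≃ ((Fin (2*k) → Fin n → ℝ) × ℝ))
    (he : ⇑e = Leg k L) (hesm' : ContDiff ℝ (⊤ : ℕ∞) (⇑e.symm))
    {H : (Fin (2*k) → Fin n → ℝ) × ℝ → ℝ} (hHsm : ContDiff ℝ (⊤ : ℕ∞) H)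
    (hH : ∀ (Q : Fin (2*k) → Fin n → ℝ) (w : ℝ),
      H (Leg k L (Q, w)) = energy k L (padJet (2*k) Q) w)
    {q : Jet n} {u : ℝ} {β : Fin (2 * k)} (hβ : k ≤ (β : ℕ))
    (i : Fin n) : pW H β i (Leg k L (restr (2 * k) q, u)) = q (β - k + 1) i := by
  rw [pW_eq_fderiv (hHsm.differentiable (by simp)),
    fderiv_hamiltonian hk hL e he hesm' hHsm hH]
  simp only [mul_comm (momentum k L _ _ q u), sum_padJet_single_mul]
  rw [Finset.sum_eq_single ((β : ℕ) - k) (fun a _ ha => if_neg (by omega))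
      (fun h => absurd (Finset.mem_range.2 (by omega)) h),
    Finset.sum_eq_zero fun a ha => if_neg (by rw [Finset.mem_range] at ha; omega),
    Finset.sum_eq_zero fun a ha => if_neg (by rw [Finset.mem_range] at ha; omega),
    if_pos (by omega)]
  simp

lemma pW_hamiltonian_position
    (hk : 1 ≤ k) (hL : SmoothL L)
    (e : ((Fin (2*k) → Fin n → ℝ) × ℝ) ≃ ((Fin (2*k) → Fin n → ℝ) × ℝ))
    (he : ⇑e = Leg k L) (hesm' : ContDiff ℝ (⊤ : ℕ∞) (⇑e.symm))
    {H : (Fin (2*k) → Fin n → ℝ) × ℝ → ℝ} (hHsm : ContDiff ℝ (⊤ : ℕ∞) H)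
    (hH : ∀ (Q : Fin (2*k) → Fin n → ℝ) (w : ℝ),
      H (Leg k L (Q, w)) = energy k L (padJet (2*k) Q) w)
    {q : Jet n} {u : ℝ} {β : Fin (2 * k)} (hβ : (β : ℕ) < k)
    (i : Fin n) : pW H β i (Leg k L (restr (2 * k) q, u))
      = (if (β : ℕ) = 0 then 0 else momentum k L β i q u) - pq (ext k L) β i q u := by
  rw [pW_eq_fderiv (hHsm.differentiable (by simp)),
    fderiv_hamiltonian hk hL e he hesm' hHsm hH]
  simp only [mul_comm (momentum k L _ _ q u), sum_padJet_single_mul]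
  rw [Finset.sum_eq_zero fun a ha => if_neg (by omega),
    Finset.sum_eq_single (s := Finset.range k) (β : ℕ) (fun a _ ha => if_neg ha)
      (fun h => absurd (Finset.mem_range.2 hβ) h)]
  obtain h0 | ⟨r, hr⟩ : (β : ℕ) = 0 ∨ ∃ r, (β : ℕ) = r + 1 := by
    cases (β : ℕ) <;> simp
  · simp [h0]
  · rw [Finset.sum_eq_single r (fun a _ ha => if_neg (by omega))
      (fun h => absurd (Finset.mem_range.2 (by omega)) h)]
    simp [hr]

lemma pWz_hamiltonian
    (hk : 1 ≤ k) (hL : SmoothL L)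
    (e : ((Fin (2*k) → Fin n → ℝ) × ℝ) ≃ ((Fin (2*k) → Fin n → ℝ) × ℝ))
    (he : ⇑e = Leg k L) (hesm' : ContDiff ℝ (⊤ : ℕ∞) (⇑e.symm))
    {H : (Fin (2*k) → Fin n → ℝ) × ℝ → ℝ} (hHsm : ContDiff ℝ (⊤ : ℕ∞) H)
    (hH : ∀ (Q : Fin (2*k) → Fin n → ℝ) (w : ℝ),
      H (Leg k L (Q, w)) = energy k L (padJet (2*k) Q) w)
    {q : Jet n} {u : ℝ} :
    pWz H (Leg k L (restr (2 * k) q, u)) = - pz (ext k L) q u := by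
  rw [pWz_eq_fderiv (hHsm.differentiable (by simp)),
    fderiv_hamiltonian hk hL e he hesm' hHsm hH]
  simp [padJet]

/-- The Legendre transform of the Hamiltonian in the momenta recovers the Lagrangian. -/
lemma sum_momentum_mul_pW_sub_hamiltonian
    (hk : 1 ≤ k) (hL : SmoothL L)
    (e : ((Fin (2*k) → Fin n → ℝ) × ℝ) ≃ ((Fin (2*k) → Fin n → ℝ) × ℝ))
    (he : ⇑e = Leg k L) (hesm' : ContDiff ℝ (⊤ : ℕ∞) (⇑e.symm))
    {H : (Fin (2*k) → Fin n → ℝ) × ℝ → ℝ} (hHsm : ContDiff ℝ (⊤ : ℕ∞) H)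
    (hH : ∀ (Q : Fin (2*k) → Fin n → ℝ) (w : ℝ),
      H (Leg k L (Q, w)) = energy k L (padJet (2*k) Q) w)
    {q : Jet n} {u : ℝ} :
    (∑ β : Fin (2*k), ∑ i : Fin n,
        if k ≤ (β : ℕ) then
          (Leg k L (restr (2 * k) q, u)).1 β i * pW H β i (Leg k L (restr (2 * k) q, u))
        else 0) - H (Leg k L (restr (2 * k) q, u)) = ext k L q u := by
  have hE : H (Leg k L (restr (2 * k) q, u)) = energy k L q u := by
    rw [hH]
    exact (isJet_energy hL hk).congr (fun α hα => padJet_restr q hα) u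
  have hS : ∀ β : Fin (2 * k), (∑ i : Fin n, if k ≤ (β : ℕ) then
      (Leg k L (restr (2 * k) q, u)).1 β i * pW H β i (Leg k L (restr (2 * k) q, u)) else 0)
      = if k ≤ (β : ℕ) then ∑ i, momentum k L (β - k + 1) i q u * q (β - k + 1) i else 0 := by
    intro β
    split_ifs with h
    · exact Finset.sum_congr rfl fun i _ => by
        rw [Leg_restr_of_le hL q u h, pW_hamiltonian_momentum hk hL e he hesm' hHsm hH h]
    · simp
  rw [Finset.sum_congr rfl fun β _ => hS β, hE, Fin.sum_univ_eq_sum_range (fun β =>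
    if k ≤ β then ∑ i, momentum k L (β - k + 1) i q u * q (β - k + 1) i else 0), two_mul,
    Finset.sum_range_add, Finset.sum_eq_zero fun β hβ =>
      if_neg (not_le.2 (Finset.mem_range.1 hβ))]
  simp [energy]

end Legendre

/-- Equivalence of the Lagrangian and Hamiltonian formalisms for
hyperregular higher-order contact systems (coordinate version). -/
theorem lagrangian_hamiltonian_equivalence
    {n k : ℕ} (hk : 1 ≤ k)
    (L : (Fin (k+1) → Fin n → ℝ) → ℝ → ℝ) (hL : SmoothL L)
    (e : ((Fin (2*k) → Fin n → ℝ) × ℝ) ≃ ((Fin (2*k) → Fin n → ℝ) × ℝ))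
    (he : ⇑e = Leg k L)
    (hesm : ContDiff ℝ (⊤ : ℕ∞) (⇑e)) (hesm' : ContDiff ℝ (⊤ : ℕ∞) (⇑e.symm))
    (H : (Fin (2*k) → Fin n → ℝ) × ℝ → ℝ) (hHsm : ContDiff ℝ (⊤ : ℕ∞) H)
    (hH : ∀ (Q : Fin (2*k) → Fin n → ℝ) (w : ℝ),
      H (Leg k L (Q, w)) = energy k L (padJet (2*k) Q) w)
    (c : ℝ → Fin n → ℝ) (hc : ContDiff ℝ (⊤ : ℕ∞) c)
    (z : ℝ → ℝ) (hz : ContDiff ℝ (⊤ : ℕ∞) z)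
    (hode : HerglotzODE k L c z) :
    HerglotzEqs k L c z ↔
    ((∀ (t : ℝ) (β : Fin (2*k)) (hβ : (β : ℕ) < k) (i : Fin n),
        HasDerivAt (fun s => (legCurve k L c z s).1 β i)
          (pW H ⟨(β : ℕ) + k, by omega⟩ i (legCurve k L c z t)) t) ∧
     (∀ (t : ℝ) (β : Fin (2*k)) (hβ : k ≤ (β : ℕ)) (i : Fin n),
        HasDerivAt (fun s => (legCurve k L c z s).1 β i)
          (-(pW H ⟨(β : ℕ) - k, by have := β.isLt; omega⟩ i (legCurve k L c z t)
              + (legCurve k L c z t).1 β i * pWz H (legCurve k L c z t))) t) ∧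
     (∀ t : ℝ,
        HasDerivAt (fun s => (legCurve k L c z s).2)
          ((∑ β : Fin (2*k), ∑ i : Fin n,
              if k ≤ (β : ℕ) then
                (legCurve k L c z t).1 β i * pW H β i (legCurve k L c z t)
              else 0)
            - H (legCurve k L c z t)) t)) := by
  have hleg : ∀ t, legCurve k L c z t = Leg k L (restr (2 * k) (lift c t), z t) := fun _ => rfl
  have hpos : ∀ t, ∀ β : Fin (2*k), (β : ℕ) < k → ∀ i,
      (legCurve k L c z t).1 β i = lift c t β i := fun t β hβ i => by
    rw [hleg, Leg_fst_of_lt _ _ hβ]; rfl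
  have hmom : ∀ t, ∀ β : Fin (2*k), k ≤ (β : ℕ) → ∀ i,
      (legCurve k L c z t).1 β i = momentum k L (β - k + 1) i (lift c t) (z t) :=
    fun t β hβ i => by rw [hleg, Leg_restr_of_le hL _ _ hβ]
  have hdmom : ∀ t, ∀ β : Fin (2*k), k ≤ (β : ℕ) → ∀ i,
      HasDerivAt (fun s => (legCurve k L c z s).1 β i)
        (pq (ext k L) (β - k) i (lift c t) (z t) - momentum k L (β - k) i (lift c t) (z t)
          + pz (ext k L) (lift c t) (z t) * momentum k L (β - k + 1) i (lift c t) (z t)) t :=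
    fun t β hβ i => by
      simp only [hmom _ β hβ]
      exact hasDerivAt_momentum hL hc hode (by omega) i t
  rw [herglotzEqs_iff]
  constructor
  · intro h
    refine ⟨fun t β hβ i => ?_, fun t β hβ i => ?_, fun t => ?_⟩
    · simp only [hpos _ β hβ]
      rw [hleg, pW_hamiltonian_momentum hk hL e he hesm' hHsm hH (by simp)]
      simpa using hasDerivAt_lift hc t β i
    · refine (hdmom t β hβ i).congr_deriv ?_
      rw [hmom t β hβ, hleg, pWz_hamiltonian hk hL e he hesm' hHsm hH,
        pW_hamiltonian_position hk hL e he hesm' hHsm hH (by dsimp only; omega)]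
      dsimp only
      split_ifs with h0
      · rw [h0, h]; ring
      · ring
    · rw [hleg, sum_momentum_mul_pW_sub_hamiltonian hk hL e he hesm' hHsm hH]
      exact hode t
  · rintro ⟨-, h, -⟩ t i
    have h1 := (h t ⟨k, by omega⟩ le_rfl i).unique (hdmom t ⟨k, by omega⟩ le_rfl i)
    rw [hmom t _ le_rfl, hleg, pWz_hamiltonian hk hL e he hesm' hHsm hH,
      pW_hamiltonian_position hk hL e he hesm' hHsm hH (by simp; omega)] at h1
    simp only [Nat.sub_self, if_true] at h1
    linarith

end HOC
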